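/- arXiv:2306.04183 — 2 statements merged into one kernel-verified Lean document; each statement's English description precedes it below -/
import Mathlib

section
/- For every point x : A → ℂ, the orbit cone of x with respect to the induced M'-grading is the image of the orbit cone with respect to the M-grading: i_ℚ(ω_M(x)) = ω_{M'}(x), where i_ℚ : M ⊗ ℚ → M' ⊗ ℚ is the ℚ-linear map induced by i. -/
open scoped BigOperators DirectSum

/-- The induced `M' = ℤ^{m'}`-grading on `A` along a lattice map `i : ℤ^m → ℤ^{m'}`:
`B_v = ⊕_{u, i(u) = v} A_u`. -/
noncomputable def inducedGrading {m m' : ℕ} {A : Type*} [CommRing A] [Algebra ℂ A]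
    (i : (Fin m → ℤ) →+ (Fin m' → ℤ)) (𝒜 : (Fin m → ℤ) → Submodule ℂ A)
    (v : Fin m' → ℤ) : Submodule ℂ A :=
  ⨆ (u : Fin m → ℤ) (_ : i u = v), 𝒜 u

/-- The canonical embedding `ℤ^n → ℚ^n`. -/
def toQ {n : ℕ} (u : Fin n → ℤ) : Fin n → ℚ := fun i => (u i : ℚ)

/-- The convex cone in `ℚ^n` generated by a set `G`. -/
def coneGen {n : ℕ} (G : Set (Fin n → ℚ)) : Set (Fin n → ℚ) :=
  {x | ∃ (k : ℕ) (c : Fin k → ℚ) (g : Fin k → (Fin n → ℚ)),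
    (∀ j, 0 ≤ c j) ∧ (∀ j, g j ∈ G) ∧ x = ∑ j, c j • g j}

/-- The orbit monoid of a (closed) point `x : A → ℂ` with respect to a grading `𝒜`:
all degrees `u` admitting a homogeneous `f ∈ 𝒜 u` with `x(f) ≠ 0`. -/
def orbitMonoid {ι A : Type*} [CommRing A] [Algebra ℂ A]
    (𝒜 : ι → Submodule ℂ A) (x : A →ₐ[ℂ] ℂ) : Set ι :=
  {u | ∃ f ∈ 𝒜 u, x f ≠ 0}

theorem orbitMonoid_induced {m m' : ℕ} {A : Type*} [CommRing A] [Algebra ℂ A]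
    (i : (Fin m → ℤ) →+ (Fin m' → ℤ)) (𝒜 : (Fin m → ℤ) → Submodule ℂ A)
    (x : A →ₐ[ℂ] ℂ) :
    orbitMonoid (inducedGrading i 𝒜) x = i '' orbitMonoid 𝒜 x := by
  ext v
  constructor
  · rintro ⟨f, hf, hx⟩
    by_contra hv
    have hle : inducedGrading i 𝒜 v ≤ LinearMap.ker x.toLinearMap := by
      refine iSup_le fun u => iSup_le fun hu => ?_
      intro g hg
      by_contra hne
      exact hv ⟨u, ⟨g, hg, fun h => hne (by simpa using h)⟩, hu⟩
    exact hx (by simpa using hle hf)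
  · rintro ⟨u, ⟨f, hf, hx⟩, rfl⟩
    have hle : 𝒜 u ≤ inducedGrading i 𝒜 (i u) :=
      le_iSup_of_le u (le_iSup_of_le rfl le_rfl)
    exact ⟨f, hle hf, hx⟩

theorem image_coneGen {m m' : ℕ} (j : (Fin m → ℚ) →ₗ[ℚ] (Fin m' → ℚ))
    (G : Set (Fin m → ℚ)) : j '' coneGen G = coneGen (j '' G) := by
  ext y
  constructor
  · rintro ⟨_, ⟨k, c, g, hc, hg, rfl⟩, rfl⟩
    exact ⟨k, c, fun l => j (g l), hc, fun l => ⟨g l, hg l, rfl⟩, by simp⟩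
  · rintro ⟨k, c, g, hc, hg, rfl⟩
    choose h hh hjh using hg
    exact ⟨_, ⟨k, c, h, hc, hh, rfl⟩, by simp [hjh]⟩

/-- For every point `x : A → ℂ`, the orbit cone with respect to the induced `M'`-grading
is the image, under the `ℚ`-linear map induced by `i`, of the orbit cone for the
`M`-grading: `i_ℚ(ω_M(x)) = ω_{M'}(x)`. -/
theorem orbitCone_induced {m m' : ℕ} {A : Type*} [CommRing A] [IsDomain A] [Algebra ℂ A]
    (hfg : Algebra.FiniteType ℂ A)
    (i : (Fin m → ℤ) →+ (Fin m' → ℤ)) (hi : Function.Surjective i)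
    (𝒜 : (Fin m → ℤ) → Submodule ℂ A) [GradedAlgebra 𝒜]
    (j : (Fin m → ℚ) →ₗ[ℚ] (Fin m' → ℚ)) (hj : ∀ u : Fin m → ℤ, j (toQ u) = toQ (i u))
    (x : A →ₐ[ℂ] ℂ) :
    j '' coneGen (toQ '' orbitMonoid 𝒜 x) =
      coneGen (toQ '' orbitMonoid (inducedGrading i 𝒜) x) := by
  rw [orbitMonoid_induced, image_coneGen, Set.image_image, Set.image_image]
  simp only [hj]
end

section
/- For every v ∈ M', the semistable locus with respect to the induced M'-grading satisfies X^{ss}_{M'}(v) = ⋃_{n > 0} ⋃_{u ∈ M : i(u) = n·v} X^{ss}_M(u). -/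
open scoped BigOperators DirectSum

/-- The semistable locus `X^{ss}(u) ⊆ Spec A` of a degree `u` with respect to a grading
`𝒜`: the union of the basic open sets `D(f)` over all `n > 0` and all `f ∈ 𝒜 (n • u)`. -/
noncomputable def ssLocus {ι A : Type*} [CommRing A] [Algebra ℂ A] [AddCommMonoid ι]
    (𝒜 : ι → Submodule ℂ A) (u : ι) : Set (PrimeSpectrum A) :=
  ⋃ (n : ℕ) (_ : 0 < n) (f ∈ 𝒜 (n • u)), {p | f ∉ p.asIdeal}

/-- For every `v ∈ M'`, the semistable locus with respect to the induced `M'`-grading is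
`X^{ss}_{M'}(v) = ⋃_{n > 0} ⋃_{u : i(u) = n·v} X^{ss}_M(u)`. -/
theorem semistable_induced {m m' : ℕ} {A : Type*} [CommRing A] [IsDomain A] [Algebra ℂ A]
    (hfg : Algebra.FiniteType ℂ A)
    (i : (Fin m → ℤ) →+ (Fin m' → ℤ)) (hi : Function.Surjective i)
    (𝒜 : (Fin m → ℤ) → Submodule ℂ A) [GradedAlgebra 𝒜]
    (v : Fin m' → ℤ) :
    ssLocus (inducedGrading i 𝒜) v =
      ⋃ (n : ℕ) (_ : 0 < n) (u : Fin m → ℤ) (_ : i u = n • v), ssLocus 𝒜 u := by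
  ext p
  simp only [ssLocus, Set.mem_iUnion, Set.mem_setOf_eq, exists_prop]
  constructor
  · rintro ⟨n, hn, f, hf, hfp⟩
    by_contra hcon
    apply hfp
    have hle : inducedGrading i 𝒜 (n • v) ≤ p.asIdeal.restrictScalars ℂ := by
      refine iSup₂_le fun u hu g hg => ?_
      by_contra hgp
      exact hcon ⟨n, hn, u, hu, 1, one_pos, g, by simpa using hg, hgp⟩
    exact hle hf
  · rintro ⟨n, hn, u, hu, k, hk, f, hf, hfp⟩
    refine ⟨k * n, Nat.mul_pos hk hn, f, ?_, hfp⟩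
    have hku : i (k • u) = (k * n) • v := by rw [map_nsmul, hu, mul_smul]
    exact (le_iSup₂_of_le (f := fun (u : Fin m → ℤ) (_ : i u = (k * n) • v) => 𝒜 u)
      (k • u) hku le_rfl) hf
end
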